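/- Let α ∈ (0,1). For each n ≥ 2 let p_n* be a real polynomial of degree ≤ α·n, not identically zero, that maximizes ‖p‖_{[−1,1]}/‖p‖_{E_n} among all such polynomials. Then limsup_{n→∞} (1/n) · log ( ‖p_n*‖_{[−1,1]} / ‖p_n*‖_{E_n} ) ≤ sup_{μ ∈ M_{α,σ}} J(μ). -/

import Mathlib

open MeasureTheory Polynomial Filter Set

/-- The `n`-grid: `n` equally spaced points in `[-1,1]` including the endpoints. -/
noncomputable def nGrid (n : ℕ) : Set ℝ :=
  {x | ∃ k : ℕ, 1 ≤ k ∧ k ≤ n ∧ x = (2 * (k : ℝ) - n - 1) / ((n : ℝ) - 1)}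

/-- Uniform norm of a real polynomial on the interval `[-1,1]`. -/
noncomputable def normI (p : Polynomial ℝ) : ℝ :=
  sSup ((fun x => |p.eval x|) '' Set.Icc (-1 : ℝ) 1)

/-- Uniform norm of a real polynomial on the `n`-grid. -/
noncomputable def normE (n : ℕ) (p : Polynomial ℝ) : ℝ :=
  sSup ((fun x => |p.eval x|) '' nGrid n)

/-- The constant `C(α)`. -/
noncomputable def Cconst (α : ℝ) : ℝ :=
  ((1 + α) * Real.log (1 + α) + (1 - α) * Real.log (1 - α)) / 2

/-- The constraining measure `σ`: density `1/2` w.r.t. Lebesgue measure on `[-1,1]`. -/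
noncomputable def sigmaM : Measure ℝ :=
  (2 : ENNReal)⁻¹ • (volume.restrict (Set.Icc (-1 : ℝ) 1))

/-- Logarithmic potential of a measure on `ℝ`. -/
noncomputable def logPot (μ : Measure ℝ) (x : ℝ) : ℝ :=
  ∫ y, Real.log (1 / |x - y|) ∂μ

/-- Topological support of a measure on `ℝ`. -/
def msupport (μ : Measure ℝ) : Set ℝ :=
  {x | ∀ U : Set ℝ, IsOpen U → x ∈ U → μ U ≠ 0}

/-- Normalized zero counting measure (zeros counted with multiplicity,
normalized by `1/n`). -/
noncomputable def zeroMeasure (n : ℕ) (p : Polynomial ℝ) : Measure ℝ :=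
  ((n : ENNReal))⁻¹ • (p.roots.map (fun x => MeasureTheory.Measure.dirac x)).sum

/-- The class of measures `M_{α,σ}`: positive measures on `[-1,1]` with total
mass `α` that are bounded above by `σ`. -/
def Mset (α : ℝ) : Set (Measure ℝ) :=
  {μ | μ ≤ sigmaM ∧ μ Set.univ = ENNReal.ofReal α}

/-- The functional `J`. -/
noncomputable def Jfun (μ : Measure ℝ) : ℝ :=
  sInf (logPot μ '' msupport (sigmaM - μ)) - sInf (logPot μ '' Set.Icc (-1 : ℝ) 1)

theorem exists_balanced_finset (K : ℕ → ℕ → ℝ) (hK : ∀ i j, K i j = K j i) {m n : ℕ}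
    (hmn : m < n) :
    ∃ B ⊆ Finset.range n, ∃ s₀ ∈ Finset.range n, s₀ ∉ B ∧ B.card = m ∧
      (∀ t ∈ Finset.range n, t ∉ B → ∑ u ∈ B, K s₀ u ≤ ∑ u ∈ B, K t u) ∧
      ∀ s ∈ insert s₀ B, ∑ u ∈ (insert s₀ B).erase s, K s u ≤ ∑ u ∈ B, K s₀ u := by
  let F : Finset ℕ → ℝ := fun S => ∑ s ∈ S, ∑ u ∈ S.erase s, K s u
  have hins : ∀ (B : Finset ℕ) (s : ℕ), s ∉ B → F (insert s B) = F B + 2 * ∑ u ∈ B, K s u := by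
    intro B s hs
    simp only [F]
    rw [Finset.sum_insert hs, Finset.erase_insert hs]
    have : ∀ b ∈ B, ∑ u ∈ (insert s B).erase b, K b u = K s b + ∑ u ∈ B.erase b, K b u := by
      intro b hb
      have hne : s ≠ b := fun h => hs (h ▸ hb)
      rw [Finset.erase_insert_of_ne hne, Finset.sum_insert (by simp [hs]), hK b s]
    rw [Finset.sum_congr rfl this, Finset.sum_add_distrib]
    ring
  obtain ⟨S, hS, hmin⟩ := Finset.exists_min_image
    ((Finset.range n).powersetCard (m + 1)) F
    (Finset.powersetCard_nonempty.2 (by simpa using hmn))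
  obtain ⟨hSn, hScard⟩ := Finset.mem_powersetCard.1 hS
  obtain ⟨s₀, hs₀, hmax⟩ := Finset.exists_max_image S (fun s => ∑ u ∈ S.erase s, K s u)
    (Finset.card_pos.1 (by omega))
  refine ⟨S.erase s₀, (Finset.erase_subset _ _).trans hSn, s₀, hSn hs₀, by simp,
    by rw [Finset.card_erase_of_mem hs₀]; omega, ?_, ?_⟩
  · intro t ht htB
    have h := hmin (insert t (S.erase s₀)) (Finset.mem_powersetCard.2
      ⟨Finset.insert_subset ht ((Finset.erase_subset _ _).trans hSn), by
        rw [Finset.card_insert_of_notMem htB, Finset.card_erase_of_mem hs₀]; omega⟩)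
    have h1 := hins _ _ (Finset.notMem_erase s₀ S)
    rw [Finset.insert_erase hs₀] at h1
    rw [hins _ _ htB, h1] at h
    linarith
  · rw [Finset.insert_erase hs₀]
    exact hmax

theorem abs_eval_le_of_interpolation {p : Polynomial ℝ} {S : Finset ℕ} {v : ℕ → ℝ}
    (hv : Set.InjOn v S) (hdeg : p.natDegree < S.card) {M C x : ℝ}
    (hM : ∀ s ∈ S, |p.eval (v s)| ≤ M)
    (hC : ∀ s ∈ S, ∏ u ∈ S.erase s, (|x - v u| / |v s - v u|) ≤ C) :
    |p.eval x| ≤ M * (S.card * C) := by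
  have hd : p.degree < S.card :=
    lt_of_le_of_lt Polynomial.degree_le_natDegree (by exact_mod_cast hdeg)
  rw [Lagrange.eq_interpolate hv hd, Lagrange.interpolate_apply, Polynomial.eval_finsetSum]
  calc _ ≤ ∑ s ∈ S, M * C := by
        refine (Finset.abs_sum_le_sum_abs _ _).trans (Finset.sum_le_sum fun s hs => ?_)
        have hb : |(Lagrange.basis S v s).eval x| ≤ C := by
          refine le_of_eq_of_le ?_ (hC s hs)
          rw [Lagrange.basis, Polynomial.eval_prod, Finset.abs_prod]
          refine Finset.prod_congr rfl fun u _ => ?_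
          simp [Lagrange.basisDivisor, abs_mul, abs_inv, div_eq_inv_mul]
        rw [Polynomial.eval_mul, Polynomial.eval_C, abs_mul]
        exact mul_le_mul (hM s hs) hb (abs_nonneg _) ((abs_nonneg _).trans (hM s hs))
    _ = M * (S.card * C) := by rw [Finset.sum_const, nsmul_eq_mul]; ring

theorem sum_log_one_add_le {n k : ℕ} (B : Finset ℕ) (hB : B ⊆ Finset.range n) (hk : k < n)
    (hkB : k ∉ B) :
    ∑ u ∈ B, Real.log (1 + 2 / |(k : ℝ) - u|) ≤ 4 * (1 + Real.log n) := by
  have hH : ∑ i ∈ Finset.range n, ((i : ℝ) + 1)⁻¹ ≤ 1 + Real.log n := by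
    have := harmonic_le_one_add_log n
    simpa [harmonic] using this
  have hle : ∀ u ∈ B, Real.log (1 + 2 / |(k : ℝ) - u|) ≤ 2 * |(k : ℝ) - u|⁻¹ := by
    intro u _
    have h0 : 0 ≤ 2 / |(k : ℝ) - u| := by positivity
    have := Real.log_le_sub_one_of_pos (x := 1 + 2 / |(k : ℝ) - u|) (by linarith)
    rw [← div_eq_mul_inv]
    linarith
  have hinj : ∀ (s : Finset ℕ) (e : ℕ → ℕ), Set.InjOn e s → (∀ u ∈ s, e u ∈ Finset.range n) →
      (∀ u ∈ s, |(k : ℝ) - u|⁻¹ = ((e u : ℝ) + 1)⁻¹) →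
      ∑ u ∈ s, |(k : ℝ) - u|⁻¹ ≤ ∑ i ∈ Finset.range n, ((i : ℝ) + 1)⁻¹ := by
    intro s e he hmem heq
    rw [Finset.sum_congr rfl heq,
      ← Finset.sum_image (f := fun i : ℕ => ((i : ℝ) + 1)⁻¹) he]
    refine Finset.sum_le_sum_of_subset_of_nonneg (Finset.image_subset_iff.2 hmem) ?_
    intros
    positivity
  have hlow := hinj (B.filter (· < k)) (fun u => k - u - 1)
    (by intro a ha b hb hab; simp at ha hb hab; omega)
    (by intro u hu; simp at hu ⊢; omega)
    (by
      intro u hu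
      have hu : u < k := (Finset.mem_filter.1 hu).2
      obtain ⟨d, rfl⟩ := Nat.exists_eq_add_of_lt hu
      congr 1
      rw [show u + d + 1 - u - 1 = d by omega]
      push_cast
      rw [abs_of_nonneg (by linarith [Nat.cast_nonneg (α := ℝ) d])]
      ring)
  have hhigh := hinj (B.filter (¬ · < k)) (fun u => u - k - 1)
    (by
      intro a ha b hb hab
      have h1 : a ≠ k := by rintro rfl; simp_all
      have h2 : b ≠ k := by rintro rfl; simp_all
      simp at ha hb hab; omega)
    (by
      intro u hu
      have hu : u < n := Finset.mem_range.1 (hB (Finset.mem_filter.1 hu).1)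
      simp; omega)
    (by
      intro u hu
      have h1 : u ≠ k := by rintro rfl; simp_all
      have hu : k < u := by have := (Finset.mem_filter.1 hu).2; omega
      obtain ⟨d, rfl⟩ := Nat.exists_eq_add_of_lt hu
      congr 1
      rw [show k + d + 1 - k - 1 = d by omega, abs_sub_comm]
      push_cast
      rw [abs_of_nonneg (by linarith [Nat.cast_nonneg (α := ℝ) d])]
      ring)
  calc _ ≤ ∑ u ∈ B, 2 * |(k : ℝ) - u|⁻¹ := Finset.sum_le_sum hle
    _ = 2 * (∑ u ∈ B with u < k, |(k : ℝ) - u|⁻¹ + ∑ u ∈ B with ¬ u < k, |(k : ℝ) - u|⁻¹) := by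
        rw [Finset.sum_filter_add_sum_filter_not, Finset.mul_sum]
    _ ≤ _ := by linarith

theorem setIntegral_comp_sub_le {g : ℝ → ℝ} (hg : IntervalIntegrable g volume (-2) 2)
    (hg0 : ∀ u, u ≠ 0 → 0 ≤ g u) {x : ℝ} (hx : x ∈ Set.Icc (-1 : ℝ) 1) {A : Set ℝ}
    (hA : A ⊆ Set.Icc (-1 : ℝ) 1) :
    ∫ y in A, g (x - y) ≤ ∫ u in (-2 : ℝ)..2, g u := by
  obtain ⟨hx1, hx2⟩ := hx
  have hsub : IntervalIntegrable g volume (x - -1) (x - 1) := by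
    refine hg.mono_set ?_
    rw [Set.uIcc_of_ge (by linarith), Set.uIcc_of_le (by norm_num)]
    exact Set.Icc_subset_Icc (by linarith) (by linarith)
  have hint : IntervalIntegrable (fun y => g (x - y)) volume (-1) 1 := by
    have := hsub.comp_sub_left x
    simpa using this
  have hae : ∀ᵐ u : ℝ, u ≠ 0 := by simp [ae_iff]
  have haex : ∀ᵐ y : ℝ, y ≠ x := by simp [ae_iff]
  calc ∫ y in A, g (x - y) ≤ ∫ y in Set.Icc (-1 : ℝ) 1, g (x - y) := by
        refine setIntegral_mono_set ?_ ?_ (Filter.Eventually.of_forall hA)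
        · exact (intervalIntegrable_iff_integrableOn_Icc_of_le (by norm_num)).1 hint
        · refine ae_restrict_of_ae ?_
          filter_upwards [haex] with y hy
          exact hg0 _ (sub_ne_zero.2 (Ne.symm hy))
    _ = ∫ y in (-1 : ℝ)..1, g (x - y) := by
        rw [intervalIntegral.integral_of_le (by norm_num), integral_Icc_eq_integral_Ioc]
    _ = ∫ u in (x - 1)..(x - -1), g u := intervalIntegral.integral_comp_sub_left g x
    _ ≤ ∫ u in (-2 : ℝ)..2, g u := by
        refine intervalIntegral.integral_mono_interval (by linarith) (by linarith) (by linarith)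
          (ae_restrict_of_ae ?_) hg
        filter_upwards [hae] with u hu
        exact hg0 u hu

theorem intervalIntegrable_log_abs (a b : ℝ) :
    IntervalIntegrable (fun u => Real.log |u|) volume a b := by
  simpa only [Real.log_abs] using intervalIntegral.intervalIntegrable_log'

theorem integrableOn_log_abs_sub (x : ℝ) {A : Set ℝ} (hA : A ⊆ Set.Icc (-1 : ℝ) 1) :
    IntegrableOn (fun y => Real.log |x - y|) A := by
  have h : IntervalIntegrable (fun y => Real.log |x - y|) volume (-1) 1 := by
    have := (intervalIntegrable_log_abs (x - -1) (x - 1)).comp_sub_left x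
    simpa using this
  exact ((intervalIntegrable_iff_integrableOn_Icc_of_le (by norm_num)).1 h).mono_set hA

theorem continuous_log_abs_add {a : ℝ} (ha : 0 < a) : Continuous fun u : ℝ => Real.log (|u| + a) :=
  (continuous_abs.add continuous_const).log fun u => (by positivity : |u| + a ≠ 0)

theorem integrableOn_log_abs_sub_add (x : ℝ) {a : ℝ} (ha : 0 < a) {A : Set ℝ}
    (hA : A ⊆ Set.Icc (-1 : ℝ) 1) : IntegrableOn (fun y => Real.log (|x - y| + a)) A :=
  (((continuous_log_abs_add ha).comp
    (continuous_const.sub continuous_id)).continuousOn.integrableOn_compact isCompact_Icc).mono_set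
    hA

/-- The total gap on `[-2,2]` between the logarithm and its regularization at scale `a`. -/
noncomputable def logGap (a : ℝ) : ℝ :=
  ∫ u in (-2 : ℝ)..2, (Real.log (|u| + a) - Real.log |u|)

theorem setIntegral_log_add_le {a : ℝ} (ha : 0 < a) {x : ℝ} (hx : x ∈ Set.Icc (-1 : ℝ) 1)
    {A : Set ℝ} (hA : A ⊆ Set.Icc (-1 : ℝ) 1) :
    ∫ y in A, Real.log (|x - y| + a) ≤ (∫ y in A, Real.log |x - y|) + logGap a := by
  have h := setIntegral_comp_sub_le (g := fun u => Real.log (|u| + a) - Real.log |u|)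
    (((continuous_log_abs_add ha).intervalIntegrable _ _).sub (intervalIntegrable_log_abs _ _))
    (fun u hu => sub_nonneg.2 (Real.log_le_log (abs_pos.2 hu) (by linarith))) hx hA
  rw [integral_sub (integrableOn_log_abs_sub_add x ha hA) (integrableOn_log_abs_sub x hA)] at h
  unfold logGap
  linarith

theorem tendsto_logGap : Tendsto logGap (nhdsWithin 0 (Set.Ioi 0)) (nhds 0) := by
  have h : Tendsto logGap (nhdsWithin 0 (Set.Ioi 0)) (nhds (∫ _ in (-2 : ℝ)..2, (0 : ℝ))) := by
    refine intervalIntegral.tendsto_integral_filter_of_dominated_convergence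
      (fun u => Real.log (|u| + 1) - Real.log |u|) ?_ ?_
      (((continuous_log_abs_add one_pos).intervalIntegrable _ _).sub
        (intervalIntegrable_log_abs _ _)) ?_
    · refine Filter.Eventually.of_forall fun a => Measurable.aestronglyMeasurable ?_
      fun_prop
    · filter_upwards [Ioo_mem_nhdsGT one_pos] with a ha
      have hae : ∀ᵐ u : ℝ, u ≠ 0 := by simp [ae_iff]
      filter_upwards [hae] with u hu _
      have hu := abs_pos.2 hu
      rw [Real.norm_eq_abs, abs_of_nonneg
        (sub_nonneg.2 (Real.log_le_log hu (by linarith [ha.1])))]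
      gcongr
      · linarith [ha.1]
      · exact ha.2.le
    · have hae : ∀ᵐ u : ℝ, u ≠ 0 := by simp [ae_iff]
      filter_upwards [hae] with u hu _
      have hu := abs_pos.2 hu
      have hc : ContinuousAt (fun a : ℝ => Real.log (|u| + a) - Real.log |u|) 0 :=
        ((continuousAt_const.add continuousAt_id).log (by simpa using hu.ne')).sub
          continuousAt_const
      have := hc.tendsto.mono_left (nhdsWithin_le_nhds (s := Set.Ioi 0))
      simpa using this
  simpa using h

theorem abs_logPot_le {μ : Measure ℝ} (hμ : μ ≤ sigmaM) {x : ℝ} (hx : x ∈ Set.Icc (-1 : ℝ) 1) :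
    |logPot μ x| ≤ ∫ u in (-2 : ℝ)..2, |Real.log (|u|)| := by
  have hint : Integrable (fun y => |Real.log (1 / |x - y|)|) sigmaM := by
    unfold sigmaM
    refine Integrable.smul_measure ?_ (by simp)
    have := (integrableOn_log_abs_sub x (subset_refl (Set.Icc (-1 : ℝ) 1))).abs
    simpa [IntegrableOn] using this
  have hK := setIntegral_comp_sub_le (g := fun u => |Real.log (|u|)|)
    (intervalIntegrable_log_abs _ _).abs (fun u _ => abs_nonneg _) hx
    (subset_refl (Set.Icc (-1 : ℝ) 1))
  have hnn : 0 ≤ ∫ y in Set.Icc (-1 : ℝ) 1, |Real.log (|x - y|)| :=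
    integral_nonneg fun _ => abs_nonneg _
  calc |logPot μ x| ≤ ∫ y, |Real.log (1 / |x - y|)| ∂μ := abs_integral_le_integral_abs
    _ ≤ ∫ y, |Real.log (1 / |x - y|)| ∂sigmaM :=
        integral_mono_measure hμ (Filter.Eventually.of_forall fun _ => abs_nonneg _) hint
    _ = 2⁻¹ * ∫ y in Set.Icc (-1 : ℝ) 1, |Real.log (|x - y|)| := by
        simp [sigmaM, integral_smul_measure]
    _ ≤ _ := by linarith

theorem bddBelow_logPot_image {μ : Measure ℝ} (hμ : μ ≤ sigmaM) :
    BddBelow (logPot μ '' Set.Icc (-1 : ℝ) 1) := by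
  refine ⟨-∫ u in (-2 : ℝ)..2, |Real.log (|u|)|, ?_⟩
  rintro _ ⟨x, hx, rfl⟩
  exact (abs_le.1 (abs_logPot_le hμ hx)).1

theorem msupport_sub_subset (μ : Measure ℝ) : msupport (sigmaM - μ) ⊆ Set.Icc (-1 : ℝ) 1 := by
  intro x hx
  by_contra h
  refine hx _ isClosed_Icc.isOpen_compl h (le_antisymm ((Measure.sub_le _).trans ?_) bot_le)
  simp [sigmaM, Measure.restrict_apply measurableSet_Icc.compl]

theorem bddAbove_Jfun_image (α : ℝ) : BddAbove (Jfun '' Mset α) := by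
  set K := ∫ u in (-2 : ℝ)..2, |Real.log (|u|)|
  have hK : 0 ≤ K := intervalIntegral.integral_nonneg (by norm_num) fun _ _ => abs_nonneg _
  refine ⟨K + K, ?_⟩
  rintro _ ⟨μ, ⟨hμ, -⟩, rfl⟩
  have h2 : -K ≤ sInf (logPot μ '' Set.Icc (-1 : ℝ) 1) := by
    refine le_csInf ⟨_, 0, by norm_num, rfl⟩ ?_
    rintro _ ⟨x, hx, rfl⟩
    exact (abs_le.1 (abs_logPot_le hμ hx)).1
  have h1 : sInf (logPot μ '' msupport (sigmaM - μ)) ≤ K := by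
    rcases (msupport (sigmaM - μ)).eq_empty_or_nonempty with h | ⟨x, hx⟩
    · simpa [h] using hK
    · exact (csInf_le ((bddBelow_logPot_image hμ).mono
        (Set.image_mono (msupport_sub_subset μ))) ⟨x, hx, rfl⟩).trans
        (abs_le.1 (abs_logPot_le hμ (msupport_sub_subset μ hx))).2
  unfold Jfun
  linarith

theorem logPot_sigmaM_restrict {A : Set ℝ} (hAm : MeasurableSet A)
    (hA : A ⊆ Set.Icc (-1 : ℝ) 1) (x : ℝ) :
    logPot (sigmaM.restrict A) x = -(2⁻¹ * ∫ y in A, Real.log |x - y|) := by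
  simp [logPot, sigmaM, Measure.restrict_restrict hAm, Set.inter_eq_left.2 hA,
    integral_neg]

/-- The `k`-th point, counted from `0`, of the `n`-grid. -/
noncomputable def gridPt (n k : ℕ) : ℝ := -1 + 2 * k / ((n : ℝ) - 1)

/-- The left endpoint of the `k`-th of `n` equal cells partitioning `[-1,1]`. -/
noncomputable def cellLeft (n k : ℕ) : ℝ := -1 + 2 / n * k

/-- The `k`-th of `n` equal cells partitioning `(-1,1]`. -/
def cell (n k : ℕ) : Set ℝ := Set.Ioc (cellLeft n k) (cellLeft n k + 2 / n)

/-- The union of the cells indexed by `B` and the initial fraction `β` of the cell `s₀`. -/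
def cellUnion (n : ℕ) (B : Finset ℕ) (s₀ : ℕ) (β : ℝ) : Set ℝ :=
  (⋃ k ∈ B, cell n k) ∪ Set.Ioc (cellLeft n s₀) (cellLeft n s₀ + 2 / n * β)

theorem abs_sub_gridPt_le {n k : ℕ} (hn : 2 ≤ n) (hk : k < n) {y : ℝ}
    (hy : y ∈ Set.Icc (cellLeft n k) (cellLeft n k + 2 / n)) : |y - gridPt n k| ≤ 2 / n := by
  have hn' : (2 : ℝ) ≤ n := by exact_mod_cast hn
  have hk' : (k : ℝ) + 1 ≤ n := by exact_mod_cast hk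
  have hk0 : (0 : ℝ) ≤ k := k.cast_nonneg
  have h1 : cellLeft n k ≤ gridPt n k := by
    have : (2 : ℝ) / n * k ≤ 2 * k / (n - 1) := by
      rw [div_mul_eq_mul_div]
      exact div_le_div_of_nonneg_left (by positivity) (by linarith) (by linarith)
    unfold cellLeft gridPt
    linarith
  have h2 : gridPt n k ≤ cellLeft n k + 2 / n := by
    have : 2 * (k : ℝ) / (n - 1) ≤ 2 / n * k + 2 / n := by
      rw [div_le_iff₀ (by linarith)]
      have : (2 / (n : ℝ) * k + 2 / n) * (n - 1) = 2 * k + 2 * (n - 1 - k) / n := by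
        field_simp
        ring
      rw [this]
      have : 0 ≤ 2 * ((n : ℝ) - 1 - k) / n := div_nonneg (by linarith) (by linarith)
      linarith
    unfold cellLeft gridPt
    linarith
  rw [abs_le]
  constructor <;> linarith [hy.1, hy.2]

theorem gridPt_mem_nGrid {n k : ℕ} (hn : 2 ≤ n) (hk : k < n) : gridPt n k ∈ nGrid n := by
  have hn' : (2 : ℝ) ≤ n := by exact_mod_cast hn
  refine ⟨k + 1, by omega, by omega, ?_⟩
  have : (n : ℝ) - 1 ≠ 0 := by linarith
  unfold gridPt
  push_cast
  field_simp
  ring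

theorem nGrid_subset {n : ℕ} (hn : 2 ≤ n) : nGrid n ⊆ Set.Icc (-1 : ℝ) 1 := by
  rintro _ ⟨k, hk1, hkn, rfl⟩
  have hn' : (2 : ℝ) ≤ n := by exact_mod_cast hn
  have hk1' : (1 : ℝ) ≤ k := by exact_mod_cast hk1
  have hkn' : (k : ℝ) ≤ n := by exact_mod_cast hkn
  constructor
  · rw [le_div_iff₀ (by linarith)]
    linarith
  · rw [div_le_iff₀ (by linarith)]
    linarith

theorem abs_gridPt_sub {n : ℕ} (hn : 2 ≤ n) (j k : ℕ) :
    |gridPt n j - gridPt n k| = 2 / ((n : ℝ) - 1) * |(j : ℝ) - k| := by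
  have hn' : (2 : ℝ) ≤ n := by exact_mod_cast hn
  have : 0 ≤ 2 / ((n : ℝ) - 1) := div_nonneg (by norm_num) (by linarith)
  conv_rhs => rw [← abs_of_nonneg this]
  rw [← abs_mul]
  unfold gridPt
  congr 1
  ring

theorem gridPt_injective {n : ℕ} (hn : 2 ≤ n) : Function.Injective (gridPt n) := by
  intro j k h
  have hn' : (2 : ℝ) ≤ n := by exact_mod_cast hn
  have h1 := abs_gridPt_sub hn j k
  rw [h, sub_self, abs_zero, eq_comm, mul_eq_zero] at h1
  rcases h1 with h1 | h1
  · exact absurd h1 (div_pos (by norm_num) (by linarith)).ne'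
  · exact_mod_cast sub_eq_zero.1 (abs_eq_zero.1 h1)

theorem Icc_cell_subset {n k : ℕ} (hk : k < n) :
    Set.Icc (cellLeft n k) (cellLeft n k + 2 / n) ⊆ Set.Icc (-1 : ℝ) 1 := by
  have hk' : (k : ℝ) + 1 ≤ n := by exact_mod_cast hk
  have hk0 : (0 : ℝ) ≤ k := k.cast_nonneg
  have hn : (0 : ℝ) < n := by linarith
  refine Set.Icc_subset_Icc ?_ ?_
  · unfold cellLeft
    have : (0 : ℝ) ≤ 2 / n * k := by positivity
    linarith
  · unfold cellLeft
    have : 2 / (n : ℝ) * k + 2 / n = 2 * ((k + 1) / n) := by ring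
    have : ((k : ℝ) + 1) / n ≤ 1 := (div_le_one hn).2 hk'
    linarith

theorem cell_subset {n k : ℕ} (hk : k < n) : cell n k ⊆ Set.Icc (-1 : ℝ) 1 :=
  Set.Ioc_subset_Icc_self.trans (Icc_cell_subset hk)

theorem measurableSet_cell {n k : ℕ} : MeasurableSet (cell n k) := measurableSet_Ioc

theorem disjoint_cell {n j k : ℕ} (hjk : j ≠ k) : Disjoint (cell n j) (cell n k) := by
  wlog h : j < k generalizing j k
  · exact (this hjk.symm (by omega)).symm
  refine Set.disjoint_left.2 fun y hj hk => ?_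
  have h' : (j : ℝ) + 1 ≤ k := by exact_mod_cast h
  have h2 : (0 : ℝ) ≤ 2 / n := by positivity
  have h3 := hj.2
  have h4 := hk.1
  unfold cellLeft at h3 h4
  nlinarith

theorem exists_mem_cell {n : ℕ} (hn : 0 < n) {y : ℝ} (hy : y ∈ Set.Ioc (-1 : ℝ) 1) :
    ∃ k < n, y ∈ cell n k := by
  have hn' : (0 : ℝ) < n := by exact_mod_cast hn
  set z := (y + 1) * (n / 2) with hz
  have hyz : y = -1 + 2 / n * z := by rw [hz]; field_simp; ring
  have hz0 : 0 < z := mul_pos (by linarith [hy.1]) (by positivity)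
  have hzn : z ≤ n := by
    rw [hz]
    nlinarith [hy.2]
  have hc0 : 0 < ⌈z⌉₊ := Nat.ceil_pos.2 hz0
  have hcn : ⌈z⌉₊ ≤ n := Nat.ceil_le.2 hzn
  obtain ⟨k, hk⟩ := Nat.exists_eq_succ_of_ne_zero hc0.ne'
  have h1 : z ≤ k + 1 := by
    have := Nat.le_ceil z
    rw [hk] at this
    exact_mod_cast this
  have h2 : (k : ℝ) < z := Nat.lt_ceil.1 (by omega)
  have hp : (0 : ℝ) < 2 / n := by positivity
  refine ⟨k, by omega, ?_, ?_⟩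
  · unfold cellLeft
    rw [hyz]
    nlinarith
  · unfold cellLeft
    rw [hyz]
    nlinarith

section CellUnion

variable {n : ℕ} {B : Finset ℕ} {s₀ : ℕ} {β : ℝ}

theorem partial_cell_subset (hβ : β ≤ 1) :
    Set.Ioc (cellLeft n s₀) (cellLeft n s₀ + 2 / n * β) ⊆ cell n s₀ := by
  refine Set.Ioc_subset_Ioc_right ?_
  have : (0 : ℝ) ≤ 2 / n := by positivity
  nlinarith

theorem measurableSet_iUnion_cell : MeasurableSet (⋃ k ∈ B, cell n k) :=
  Finset.measurableSet_biUnion _ fun _ _ => measurableSet_cell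

theorem measurableSet_cellUnion : MeasurableSet (cellUnion n B s₀ β) :=
  measurableSet_iUnion_cell.union measurableSet_Ioc

theorem cellUnion_subset (hB : B ⊆ Finset.range n) (hs₀ : s₀ < n) (hβ : β ≤ 1) :
    cellUnion n B s₀ β ⊆ Set.Icc (-1 : ℝ) 1 :=
  Set.union_subset
    (Set.iUnion₂_subset fun _ hk => cell_subset (Finset.mem_range.1 (hB hk)))
    ((partial_cell_subset hβ).trans (cell_subset hs₀))

theorem disjoint_iUnion_cell (hs₀B : s₀ ∉ B) (hβ : β ≤ 1) :
    Disjoint (⋃ k ∈ B, cell n k) (Set.Ioc (cellLeft n s₀) (cellLeft n s₀ + 2 / n * β)) := by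
  refine Set.disjoint_iUnion₂_left.2 fun k hk => ?_
  have hne : k ≠ s₀ := fun h => hs₀B (h ▸ hk)
  exact (disjoint_cell hne).mono_right (partial_cell_subset hβ)

theorem setIntegral_cellUnion (hs₀B : s₀ ∉ B) (hβ : β ≤ 1) {f : ℝ → ℝ}
    (hf : IntegrableOn f (cellUnion n B s₀ β)) :
    ∫ y in cellUnion n B s₀ β, f y = (∑ k ∈ B, ∫ y in cell n k, f y) +
      ∫ y in Set.Ioc (cellLeft n s₀) (cellLeft n s₀ + 2 / n * β), f y := by
  have h1 : IntegrableOn f (⋃ k ∈ B, cell n k) := hf.mono_set Set.subset_union_left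
  rw [cellUnion, setIntegral_union (disjoint_iUnion_cell hs₀B hβ) measurableSet_Ioc h1
    (hf.mono_set Set.subset_union_right),
    integral_biUnion_finset B (fun _ _ => measurableSet_cell)
      (fun _ _ _ _ hjk => disjoint_cell hjk)
      (fun k hk => h1.mono_set (Set.subset_biUnion_of_mem (u := fun k => cell n k) hk))]

theorem volume_cellUnion (hs₀B : s₀ ∉ B) (hβ0 : 0 ≤ β) (hβ : β ≤ 1) :
    volume (cellUnion n B s₀ β) = ENNReal.ofReal (2 / n * (B.card + β)) := by
  have h2 : (0 : ℝ) ≤ 2 / n := by positivity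
  rw [cellUnion, measure_union (disjoint_iUnion_cell hs₀B hβ) measurableSet_Ioc,
    measure_biUnion_finset (fun _ _ _ _ hjk => disjoint_cell hjk) fun _ _ => measurableSet_cell]
  simp only [cell, Real.volume_Ioc, add_sub_cancel_left, Finset.sum_const]
  rw [← ENNReal.ofReal_nsmul, ← ENNReal.ofReal_add (by positivity) (by positivity), nsmul_eq_mul]
  congr 1
  ring

theorem restrict_cellUnion_mem_Mset {α : ℝ} (hn : 0 < n) (hB : B ⊆ Finset.range n)
    (hs₀ : s₀ < n) (hs₀B : s₀ ∉ B) (hβ0 : 0 ≤ β) (hβ : β ≤ 1) (hα : B.card + β = α * n) :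
    sigmaM.restrict (cellUnion n B s₀ β) ∈ Mset α := by
  refine ⟨Measure.restrict_le_self, ?_⟩
  have hn' : (n : ℝ) ≠ 0 := by positivity
  rw [Measure.restrict_apply_univ, sigmaM, Measure.smul_apply,
    Measure.restrict_apply measurableSet_cellUnion,
    Set.inter_eq_left.2 (cellUnion_subset hB hs₀ hβ), volume_cellUnion hs₀B hβ0 hβ, hα,
    show 2 / (n : ℝ) * (α * n) = 2 * α by field_simp, ENNReal.ofReal_mul (by norm_num), smul_eq_mul,
    ← mul_assoc]
  simp [ENNReal.inv_mul_cancel]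

theorem sigmaM_sub_restrict {A : Set ℝ} (hA : MeasurableSet A) :
    sigmaM - sigmaM.restrict A = sigmaM.restrict Aᶜ := by
  have : IsFiniteMeasure sigmaM := ⟨by simp [sigmaM, ENNReal.mul_lt_top_iff]⟩
  conv_lhs => rw [← Measure.restrict_add_restrict_compl (μ := sigmaM) hA]
  rw [add_comm, Measure.restrict_add, Measure.restrict_restrict hA,
    Measure.restrict_restrict hA]
  simp [Measure.add_sub_cancel]

theorem msupport_nonempty {μ : Measure ℝ} (hμ : μ ≠ 0) : (msupport μ).Nonempty := by
  by_contra h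
  refine hμ (Measure.measure_univ_eq_zero.1 (measure_null_of_locally_null _ fun x _ => ?_))
  have hx : x ∉ msupport μ := fun hx => h ⟨x, hx⟩
  simp only [msupport, Set.mem_ofPred_eq, not_forall, not_not] at hx
  obtain ⟨U, hU, hxU, h0⟩ := hx
  exact ⟨U, mem_nhdsWithin_of_mem_nhds (hU.mem_nhds hxU), h0⟩

theorem exists_cell_of_mem_msupport (hn : 0 < n) {x : ℝ}
    (hx : x ∈ msupport (sigmaM - sigmaM.restrict (cellUnion n B s₀ β))) :
    ∃ k < n, k ∉ B ∧ x ∈ Set.Icc (cellLeft n k) (cellLeft n k + 2 / n) := by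
  by_contra! h
  rw [sigmaM_sub_restrict measurableSet_cellUnion] at hx
  set F : Set ℝ := ⋃ k ∈ Finset.range n \ B, Set.Icc (cellLeft n k) (cellLeft n k + 2 / n) with hF
  have hFc : IsClosed F := isClosed_biUnion_finset fun _ _ => isClosed_Icc
  refine hx Fᶜ hFc.isOpen_compl ?_ ?_
  · simp only [hF, Set.mem_compl_iff, Set.mem_iUnion, Finset.mem_sdiff, Finset.mem_range,
      not_exists]
    exact fun k hk => h k hk.1 hk.2
  · rw [Measure.restrict_apply hFc.isOpen_compl.measurableSet, sigmaM, Measure.smul_apply,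
      Measure.restrict_apply
        (hFc.isOpen_compl.measurableSet.inter measurableSet_cellUnion.compl)]
    have hsub : Fᶜ ∩ (cellUnion n B s₀ β)ᶜ ∩ Set.Icc (-1 : ℝ) 1 ⊆ {-1} := by
      rintro y ⟨⟨hyF, hyA⟩, hy1, hy2⟩
      by_contra hne
      obtain ⟨k, hk, hyk⟩ := exists_mem_cell hn ⟨lt_of_le_of_ne hy1 (Ne.symm hne), hy2⟩
      by_cases hkB : k ∈ B
      · exact hyA (Or.inl (Set.mem_biUnion hkB hyk))
      · exact hyF (Set.mem_biUnion (by simp [hk, hkB]) (Set.Ioc_subset_Icc_self hyk))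
    rw [measure_mono_null hsub (by simp), smul_zero]

end CellUnion

theorem setIntegral_Ioc_le_mul {f : ℝ → ℝ} {a l c x : ℝ} (hl : 0 ≤ l)
    (hf : IntegrableOn f (Set.Ioc a (a + l))) (hc : ∀ y ∈ Set.Ioc a (a + l), y ≠ x → f y ≤ c) :
    ∫ y in Set.Ioc a (a + l), f y ≤ l * c := by
  have hae : ∀ᵐ y : ℝ, y ≠ x := by simp [ae_iff]
  have h := setIntegral_mono_on_ae hf (integrableOn_const (C := c) (by simp)) measurableSet_Ioc
    (by filter_upwards [hae] with y hy hmem using hc y hmem hy)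
  simpa [hl] using h

theorem mul_le_setIntegral_Ioc {f : ℝ → ℝ} {a l c x : ℝ} (hl : 0 ≤ l)
    (hf : IntegrableOn f (Set.Ioc a (a + l))) (hc : ∀ y ∈ Set.Ioc a (a + l), y ≠ x → c ≤ f y) :
    l * c ≤ ∫ y in Set.Ioc a (a + l), f y := by
  have h := setIntegral_Ioc_le_mul (f := fun y => -f y) (c := -c) hl hf.neg
    fun y hy hne => neg_le_neg (hc y hy hne)
  rw [integral_neg] at h
  linarith

section Comparison

variable {n : ℕ} {B : Finset ℕ} {s₀ : ℕ} {β : ℝ}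

theorem sum_le_mul_logPot (hn : 2 ≤ n) (hB : B ⊆ Finset.range n) (hs₀ : s₀ < n) (hs₀B : s₀ ∉ B)
    (hβ0 : 0 ≤ β) (hβ : β ≤ 1) {k : ℕ} (hk : k < n) (hkB : k ∉ B) {t : ℝ}
    (ht : t ∈ Set.Icc (-1 : ℝ) 1) (htk : |t - gridPt n k| ≤ 2 / n) :
    ∑ u ∈ B, -Real.log |gridPt n k - gridPt n u| ≤
      n * logPot (sigmaM.restrict (cellUnion n B s₀ β)) t +
        (4 * (1 + Real.log n) + Real.log 2) := by
  have hn' : (2 : ℝ) ≤ n := by exact_mod_cast hn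
  have h2n : (0 : ℝ) ≤ 2 / n := by positivity
  have hA := cellUnion_subset hB hs₀ hβ
  rw [logPot_sigmaM_restrict measurableSet_cellUnion hA,
    setIntegral_cellUnion hs₀B hβ (integrableOn_log_abs_sub t hA)]
  have hcell : ∀ u ∈ B, ∫ y in cell n u, Real.log |t - y| ≤
      2 / n * (Real.log |gridPt n k - gridPt n u| + Real.log (1 + 2 / |(k : ℝ) - u|)) := by
    intro u hu
    have hun : u < n := Finset.mem_range.1 (hB hu)
    have hku : 0 < |(k : ℝ) - u| := by
      refine abs_pos.2 (sub_ne_zero.2 fun h => hkB ?_)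
      rwa [Nat.cast_injective h]
    have hd : 2 / (n : ℝ) * |(k : ℝ) - u| ≤ |gridPt n k - gridPt n u| := by
      rw [abs_gridPt_sub hn]
      gcongr
      · linarith
      · linarith
    have hdpos : 0 < |gridPt n k - gridPt n u| := lt_of_lt_of_le (by positivity) hd
    refine setIntegral_Ioc_le_mul (x := t) h2n (integrableOn_log_abs_sub t (cell_subset hun)) ?_
    intro y hy hne
    rw [← Real.log_mul hdpos.ne' (by positivity)]
    refine Real.log_le_log (abs_pos.2 (sub_ne_zero.2 (Ne.symm hne))) ?_
    have hyu := abs_sub_gridPt_le hn hun (Set.Ioc_subset_Icc_self hy)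
    have h3 : 2 / (n : ℝ) ≤ |gridPt n k - gridPt n u| / |(k : ℝ) - u| := by
      rwa [le_div_iff₀ hku]
    have h4 : |t - y| ≤ |t - gridPt n k| + |gridPt n k - gridPt n u| + |y - gridPt n u| := by
      rw [abs_sub_comm y]
      exact (abs_sub_le _ (gridPt n u) _).trans (by linarith [abs_sub_le t (gridPt n k) (gridPt n u)])
    calc |t - y| ≤ |gridPt n k - gridPt n u| + 2 * (2 / n) := by linarith
      _ ≤ |gridPt n k - gridPt n u| + 2 * (|gridPt n k - gridPt n u| / |(k : ℝ) - u|) := by gcongr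
      _ = |gridPt n k - gridPt n u| * (1 + 2 / |(k : ℝ) - u|) := by ring
  have hpart : ∫ y in Set.Ioc (cellLeft n s₀) (cellLeft n s₀ + 2 / n * β), Real.log |t - y| ≤
      2 / n * β * Real.log 2 := by
    have hsub := (partial_cell_subset (n := n) (s₀ := s₀) hβ).trans (cell_subset hs₀)
    refine setIntegral_Ioc_le_mul (x := t) (by positivity) (integrableOn_log_abs_sub t hsub) ?_
    intro y hy hne
    refine Real.log_le_log (abs_pos.2 (sub_ne_zero.2 (Ne.symm hne))) (abs_le.2 ?_)
    have := hsub hy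
    constructor <;> linarith [ht.1, ht.2, this.1, this.2]
  have hlog2 : 0 < Real.log 2 := Real.log_pos (by norm_num)
  have hpart' : 2 / n * β * Real.log 2 ≤ 2 / n * Real.log 2 := by
    gcongr
    nlinarith
  have hsum := Finset.sum_le_sum hcell
  rw [← Finset.mul_sum, Finset.sum_add_distrib] at hsum
  have hH := sum_log_one_add_le B hB hk hkB
  rw [Finset.sum_neg_distrib]
  set I := (∑ u ∈ B, ∫ y in cell n u, Real.log |t - y|) +
    ∫ y in Set.Ioc (cellLeft n s₀) (cellLeft n s₀ + 2 / n * β), Real.log |t - y|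
  set T := ∑ u ∈ B, Real.log |gridPt n k - gridPt n u|
  have hI : I ≤ 2 / n * (T + 4 * (1 + Real.log n) + Real.log 2) := by
    have : 2 / (n : ℝ) * ∑ u ∈ B, Real.log (1 + 2 / |(k : ℝ) - u|) ≤
      2 / n * (4 * (1 + Real.log n)) := by gcongr
    simp only [I]
    linarith
  have : n * (2⁻¹ * I) ≤ T + 4 * (1 + Real.log n) + Real.log 2 := by
    calc n * (2⁻¹ * I) ≤ n * (2⁻¹ * (2 / n * (T + 4 * (1 + Real.log n) + Real.log 2))) := by
          gcongr
      _ = _ := by field_simp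
  linarith

theorem sum_log_le_neg_mul_logPot (hn : 2 ≤ n) (hB : B ⊆ Finset.range n) (hs₀ : s₀ < n)
    (hs₀B : s₀ ∉ B) (hβ0 : 0 ≤ β) (hβ : β ≤ 1) {x : ℝ} (hx : x ∈ Set.Icc (-1 : ℝ) 1) :
    ∑ u ∈ B, Real.log (|x - gridPt n u| + 2 / n) ≤
      -(n * logPot (sigmaM.restrict (cellUnion n B s₀ β)) x) +
        (n / 2 * logGap (4 / n) + Real.log n) := by
  have hn' : (2 : ℝ) ≤ n := by exact_mod_cast hn
  have h2n : (0 : ℝ) < 2 / n := by positivity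
  have h4n : (0 : ℝ) < 4 / n := by positivity
  have hA := cellUnion_subset hB hs₀ hβ
  have hgap := setIntegral_log_add_le h4n hx hA
  rw [setIntegral_cellUnion hs₀B hβ (integrableOn_log_abs_sub_add x h4n hA)] at hgap
  rw [logPot_sigmaM_restrict measurableSet_cellUnion hA]
  have hcell : ∀ u ∈ B, 2 / n * Real.log (|x - gridPt n u| + 2 / n) ≤
      ∫ y in cell n u, Real.log (|x - y| + 4 / n) := by
    intro u hu
    have hun : u < n := Finset.mem_range.1 (hB hu)
    refine mul_le_setIntegral_Ioc (x := x) h2n.le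
      (integrableOn_log_abs_sub_add x h4n (cell_subset hun)) fun y hy _ => ?_
    refine Real.log_le_log (by positivity) ?_
    have hyu := abs_sub_gridPt_le hn hun (Set.Ioc_subset_Icc_self hy)
    have := abs_sub_le x y (gridPt n u)
    have : (4 : ℝ) / n = 2 / n + 2 / n := by ring
    linarith
  have hlogn : 0 ≤ Real.log n := Real.log_nonneg (by linarith)
  have hpart : 2 / n * β * -Real.log n ≤
      ∫ y in Set.Ioc (cellLeft n s₀) (cellLeft n s₀ + 2 / n * β), Real.log (|x - y| + 4 / n) := by
    have hsub := (partial_cell_subset (n := n) (s₀ := s₀) hβ).trans (cell_subset hs₀)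
    refine mul_le_setIntegral_Ioc (x := x) (by positivity)
      (integrableOn_log_abs_sub_add x h4n hsub) fun y _ _ => ?_
    rw [← Real.log_inv]
    refine Real.log_le_log (by positivity) ?_
    have : (n : ℝ)⁻¹ ≤ 4 / n := by
      rw [inv_eq_one_div]
      gcongr
      norm_num
    linarith [abs_nonneg (x - y)]
  have hpart' : 2 / n * β * Real.log n ≤ 2 / n * Real.log n := by
    gcongr
    nlinarith
  have hsum := Finset.sum_le_sum hcell
  rw [← Finset.mul_sum] at hsum
  set T := ∑ u ∈ B, Real.log (|x - gridPt n u| + 2 / n)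
  set I := ∫ y in cellUnion n B s₀ β, Real.log |x - y|
  have hI : 2 / n * (T - Real.log n) ≤ I + logGap (4 / n) := by linarith
  have : T - Real.log n ≤ n / 2 * (I + logGap (4 / n)) := by
    calc T - Real.log n = n / 2 * (2 / n * (T - Real.log n)) := by field_simp
      _ ≤ _ := by gcongr
  linarith

end Comparison

/-- The logarithmic error term of the comparison between polynomials and potentials. -/
noncomputable def comparisonError (n : ℕ) : ℝ :=
  n / 2 * logGap (4 / n) + (8 * Real.log n + 4 + Real.log 2 + Real.log 3)

theorem exists_measure_abs_eval_le {α : ℝ} (hα : α ∈ Set.Ioo (0 : ℝ) 1) {n : ℕ} (hn : 2 ≤ n) :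
    ∃ μ ∈ Mset α, ∀ p : Polynomial ℝ, (p.natDegree : ℝ) ≤ α * n → ∀ M,
      (∀ y ∈ nGrid n, |p.eval y| ≤ M) → ∀ x ∈ Set.Icc (-1 : ℝ) 1,
      |p.eval x| ≤ M * Real.exp (n * Jfun μ + comparisonError n) := by
  have hn' : (2 : ℝ) ≤ n := by exact_mod_cast hn
  have hn0 : 0 < n := by omega
  have hlogn : 0 ≤ Real.log n := Real.log_nonneg (by linarith)
  have hαn : 0 ≤ α * n := mul_nonneg hα.1.le (by linarith)
  have hm : ⌊α * n⌋₊ < n := (Nat.floor_lt hαn).2 (by nlinarith [hα.2])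
  obtain ⟨B, hB, s₀, hs₀, hs₀B, hcard, hout, hin⟩ := exists_balanced_finset
    (fun j k => -Real.log |gridPt n j - gridPt n k|) (fun j k => by simp only [abs_sub_comm]) hm
  set w := ∑ u ∈ B, -Real.log |gridPt n s₀ - gridPt n u|
  have hs₀n : s₀ < n := Finset.mem_range.1 hs₀
  set β := α * n - ⌊α * n⌋₊ with hβdef
  have hβ0 : 0 ≤ β := sub_nonneg.2 (Nat.floor_le hαn)
  have hβ : β ≤ 1 := by linarith [Nat.lt_floor_add_one (α * n)]
  set μ := sigmaM.restrict (cellUnion n B s₀ β) with hμ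
  have hμM : μ ∈ Mset α := restrict_cellUnion_mem_Mset hn0 hB hs₀n hs₀B hβ0 hβ
    (by rw [hcard, hβdef]; ring)
  refine ⟨μ, hμM, fun p hp M hM x hx => ?_⟩
  have hw : w ≤ n * sInf (logPot μ '' msupport (sigmaM - μ)) +
      (4 * (1 + Real.log n) + Real.log 2) := by
    have hne : (msupport (sigmaM - μ)).Nonempty := by
      refine msupport_nonempty fun h => ?_
      have h1 : μ Set.univ = sigmaM Set.univ := by
        rw [sigmaM_sub_restrict measurableSet_cellUnion] at h
        rw [← Measure.restrict_add_restrict_compl (μ := sigmaM)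
          (measurableSet_cellUnion (n := n) (B := B) (s₀ := s₀) (β := β)), h, add_zero]
      rw [hμM.2] at h1
      have h2 : sigmaM Set.univ = 1 := by
        simp only [sigmaM, Measure.smul_apply, Measure.restrict_apply_univ, Real.volume_Icc]
        norm_num
        exact ENNReal.inv_mul_cancel (by simp) (by simp)
      rw [h2, ENNReal.ofReal_eq_one] at h1
      exact hα.2.ne h1
    have : (w - (4 * (1 + Real.log n) + Real.log 2)) / n ≤
        sInf (logPot μ '' msupport (sigmaM - μ)) := by
      refine le_csInf (hne.image _) ?_
      rintro _ ⟨t, ht, rfl⟩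
      obtain ⟨k, hk, hkB, htk⟩ := exists_cell_of_mem_msupport hn0 ht
      have h1 := hout k (Finset.mem_range.2 hk) hkB
      have h2 := sum_le_mul_logPot hn hB hs₀n hs₀B hβ0 hβ hk hkB (msupport_sub_subset _ ht)
        (abs_sub_gridPt_le hn hk htk)
      rw [div_le_iff₀ (by linarith)]
      linarith
    rw [div_le_iff₀ (by linarith)] at this
    linarith
  have hinf : sInf (logPot μ '' Set.Icc (-1 : ℝ) 1) ≤ logPot μ x :=
    csInf_le (bddBelow_logPot_image hμM.1) ⟨x, hx, rfl⟩
  have hVx := sum_log_le_neg_mul_logPot hn hB hs₀n hs₀B hβ0 hβ hx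
  set S := insert s₀ B with hS
  have hSn : S ⊆ Finset.range n := Finset.insert_subset hs₀ hB
  have hScard : S.card = ⌊α * n⌋₊ + 1 := by rw [hS, Finset.card_insert_of_notMem hs₀B, hcard]
  have hM0 : 0 ≤ M := (abs_nonneg _).trans (hM _ (gridPt_mem_nGrid hn hs₀n))
  have hbasis : ∀ s ∈ S, ∏ u ∈ S.erase s, (|x - gridPt n u| / |gridPt n s - gridPt n u|) ≤
      Real.exp (n * Jfun μ + comparisonError n - Real.log n) := by
    intro s hs
    have hpos : ∀ u ∈ S.erase s, 0 < |gridPt n s - gridPt n u| := fun u hu =>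
      abs_pos.2 (sub_ne_zero.2 ((gridPt_injective hn).ne (Finset.ne_of_mem_erase hu).symm))
    have hL : ∀ u, 0 < |x - gridPt n u| + 2 / n := fun u => by positivity
    calc ∏ u ∈ S.erase s, (|x - gridPt n u| / |gridPt n s - gridPt n u|)
        ≤ ∏ u ∈ S.erase s, Real.exp (Real.log (|x - gridPt n u| + 2 / n) +
            -Real.log |gridPt n s - gridPt n u|) := by
          refine Finset.prod_le_prod (fun _ _ => by positivity) fun u hu => ?_
          rw [Real.exp_add, Real.exp_neg, Real.exp_log (hL u), Real.exp_log (hpos u hu),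
            ← div_eq_mul_inv]
          gcongr
          have : (0 : ℝ) ≤ 2 / n := by positivity
          linarith
      _ = Real.exp (∑ u ∈ S.erase s, Real.log (|x - gridPt n u| + 2 / n) +
            ∑ u ∈ S.erase s, -Real.log |gridPt n s - gridPt n u|) := by
          rw [← Real.exp_sum, Finset.sum_add_distrib]
      _ ≤ _ := by
          refine Real.exp_le_exp.2 ?_
          have hVs := hin s hs
          have hsplit : ∑ u ∈ S.erase s, Real.log (|x - gridPt n u| + 2 / n) =
              Real.log (|x - gridPt n s₀| + 2 / n) +
                ∑ u ∈ B, Real.log (|x - gridPt n u| + 2 / n) -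
                Real.log (|x - gridPt n s| + 2 / n) := by
            rw [Finset.sum_erase_eq_sub hs, hS, Finset.sum_insert hs₀B]
          have h3 : Real.log (|x - gridPt n s₀| + 2 / n) ≤ Real.log 3 := by
            refine Real.log_le_log (hL _) ?_
            have h1 : (2 : ℝ) / n ≤ 1 := (div_le_one (by linarith)).2 hn'
            have hg := nGrid_subset hn (gridPt_mem_nGrid hn hs₀n)
            have : |x - gridPt n s₀| ≤ 2 := abs_le.2
              ⟨by linarith [hx.1, hg.2], by linarith [hx.2, hg.1]⟩
            linarith
          have h4 : -Real.log n ≤ Real.log (|x - gridPt n s| + 2 / n) := by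
            rw [← Real.log_inv]
            refine Real.log_le_log (by positivity) ?_
            have : (n : ℝ)⁻¹ ≤ 2 / n := by
              rw [inv_eq_one_div]
              gcongr
              norm_num
            linarith [abs_nonneg (x - gridPt n s)]
          have hJ : n * sInf (logPot μ '' msupport (sigmaM - μ)) - n * logPot μ x ≤
              n * Jfun μ := by
            unfold Jfun
            rw [← mul_sub]
            gcongr
          unfold comparisonError
          linarith
  have hdeg : p.natDegree < S.card := by
    rw [hScard, Nat.lt_succ_iff]
    exact Nat.le_floor hp
  have key := abs_eval_le_of_interpolation (gridPt_injective hn).injOn hdeg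
    (fun s hs => hM _ (gridPt_mem_nGrid hn (Finset.mem_range.1 (hSn hs)))) hbasis
  refine key.trans ?_
  gcongr
  calc (S.card : ℝ) * Real.exp (n * Jfun μ + comparisonError n - Real.log n)
      ≤ n * Real.exp (n * Jfun μ + comparisonError n - Real.log n) := by
        gcongr
        omega
    _ = _ := by
        rw [Real.exp_sub, Real.exp_log (by linarith)]
        field_simp

theorem tendsto_comparisonError_div :
    Tendsto (fun n : ℕ => comparisonError n / n) atTop (nhds 0) := by
  have hlog : Tendsto (fun n : ℕ => Real.log n / (n : ℝ)) atTop (nhds 0) :=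
    Real.isLittleO_log_id_atTop.tendsto_div_nhds_zero.comp tendsto_natCast_atTop_atTop
  have hgap : Tendsto (fun n : ℕ => logGap (4 / n)) atTop (nhds 0) := by
    refine tendsto_logGap.comp (tendsto_nhdsWithin_iff.2 ⟨?_, ?_⟩)
    · exact tendsto_const_div_atTop_nhds_zero_nat 4
    · filter_upwards [eventually_gt_atTop 0] with n hn
      exact Set.mem_Ioi.2 (by positivity)
  have h := ((hgap.const_mul (1 / 2)).add (hlog.const_mul 8)).add
    (tendsto_const_div_atTop_nhds_zero_nat (4 + Real.log 2 + Real.log 3))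
  simp only [mul_zero, add_zero] at h
  refine h.congr' ?_
  filter_upwards [eventually_gt_atTop 0] with n hn
  have : (n : ℝ) ≠ 0 := by positivity
  unfold comparisonError
  field_simp
  ring

theorem abs_eval_le_normI (p : Polynomial ℝ) {x : ℝ} (hx : x ∈ Set.Icc (-1 : ℝ) 1) :
    |p.eval x| ≤ normI p :=
  le_csSup (isCompact_Icc.image (by fun_prop)).bddAbove ⟨x, hx, rfl⟩

theorem abs_eval_le_normE {n : ℕ} (hn : 2 ≤ n) (p : Polynomial ℝ) {x : ℝ} (hx : x ∈ nGrid n) :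
    |p.eval x| ≤ normE n p :=
  le_csSup ((isCompact_Icc.image (f := fun x => |p.eval x|) (by fun_prop)).bddAbove.mono
    (Set.image_mono (nGrid_subset hn))) ⟨x, hx, rfl⟩

theorem normE_le_normI {n : ℕ} (hn : 2 ≤ n) (p : Polynomial ℝ) : normE n p ≤ normI p := by
  refine csSup_le (Set.Nonempty.image _ ⟨_, gridPt_mem_nGrid hn (show 0 < n by omega)⟩) ?_
  rintro _ ⟨x, hx, rfl⟩
  exact abs_eval_le_normI p (nGrid_subset hn hx)

theorem normI_pos {p : Polynomial ℝ} (hp : p ≠ 0) : 0 < normI p := by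
  by_contra h
  refine hp (Polynomial.eq_zero_of_infinite_isRoot p
    ((Set.Icc_infinite (show (-1 : ℝ) < 1 by norm_num)).mono fun x hx => ?_))
  exact abs_nonpos_iff.1 ((abs_eval_le_normI p hx).trans (not_lt.1 h))

theorem log_ratio_bounds {α : ℝ} (hα : α ∈ Set.Ioo (0 : ℝ) 1) {n : ℕ} (hn : 2 ≤ n)
    {p : Polynomial ℝ} (hp : p ≠ 0) (hdeg : (p.natDegree : ℝ) ≤ α * n) :
    0 ≤ (n : ℝ)⁻¹ * Real.log (normI p / normE n p) ∧
      (n : ℝ)⁻¹ * Real.log (normI p / normE n p) ≤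
        sSup (Jfun '' Mset α) + comparisonError n / n := by
  have hn' : (2 : ℝ) ≤ n := by exact_mod_cast hn
  obtain ⟨μ, hμ, hle⟩ := exists_measure_abs_eval_le hα hn
  have hI : normI p ≤ normE n p * Real.exp (n * Jfun μ + comparisonError n) := by
    refine csSup_le ((Set.nonempty_Icc.2 (by norm_num)).image _) ?_
    rintro _ ⟨x, hx, rfl⟩
    exact hle p hdeg _ (fun y hy => abs_eval_le_normE hn p hy) x hx
  have hIpos := normI_pos hp
  have hEpos : 0 < normE n p := pos_of_mul_pos_left (hIpos.trans_le hI) (Real.exp_pos _).le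
  have hlog : Real.log (normI p / normE n p) ≤ n * Jfun μ + comparisonError n := by
    rw [Real.log_le_iff_le_exp (by positivity), div_le_iff₀ hEpos, mul_comm]
    exact hI
  have hJ : Jfun μ ≤ sSup (Jfun '' Mset α) := le_csSup (bddAbove_Jfun_image α) ⟨μ, hμ, rfl⟩
  constructor
  · have := Real.log_nonneg ((one_le_div hEpos).2 (normE_le_normI hn p))
    positivity
  · calc (n : ℝ)⁻¹ * Real.log (normI p / normE n p)
        ≤ (n : ℝ)⁻¹ * (n * Jfun μ + comparisonError n) := by gcongr
      _ = Jfun μ + comparisonError n / n := by field_simp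
      _ ≤ _ := by gcongr

theorem extremal_ratio_limsup_le_supJ (α : ℝ) (hα : α ∈ Set.Ioo (0 : ℝ) 1)
    (P : ℕ → Polynomial ℝ)
    (hne : ∀ n : ℕ, 2 ≤ n → P n ≠ 0)
    (hdeg : ∀ n : ℕ, 2 ≤ n → ((P n).natDegree : ℝ) ≤ α * n)
    (hmax : ∀ n : ℕ, 2 ≤ n → ∀ q : Polynomial ℝ, q ≠ 0 → (q.natDegree : ℝ) ≤ α * n →
      normI q / normE n q ≤ normI (P n) / normE n (P n)) :
    Filter.limsup (fun n : ℕ =>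
        (n : ℝ)⁻¹ * Real.log (normI (P n) / normE n (P n))) atTop ≤
      sSup (Jfun '' Mset α) := by
  have hbounds : ∀ᶠ n : ℕ in atTop,
      0 ≤ (n : ℝ)⁻¹ * Real.log (normI (P n) / normE n (P n)) ∧
      (n : ℝ)⁻¹ * Real.log (normI (P n) / normE n (P n)) ≤
        sSup (Jfun '' Mset α) + comparisonError n / n := by
    filter_upwards [eventually_ge_atTop 2] with n hn
    exact log_ratio_bounds hα hn (hne n hn) (hdeg n hn)
  have hlim : Tendsto (fun n : ℕ => sSup (Jfun '' Mset α) + comparisonError n / n) atTop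
      (nhds (sSup (Jfun '' Mset α))) := by
    simpa using tendsto_comparisonError_div.const_add (sSup (Jfun '' Mset α))
  refine (limsup_le_limsup (hbounds.mono fun _ h => h.2) ?_ hlim.isBoundedUnder_le).trans_eq
    hlim.limsup_eq
  exact (Filter.isBoundedUnder_of_eventually_ge (hbounds.mono fun _ h => h.1)).isCoboundedUnder_le
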